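/- arXiv:2505.23390 — 4 statements merged into one kernel-verified Lean document; each statement's English description precedes it below -/
import Mathlib

section
/- Let u : ℝ × ℝ → ℝ be a C^∞ function of (t,x) with u(t,x) ≠ 0 for all (t,x), and let ε ∈ ℝ. Set Δ = u_t − u^{-2} u_{xx} + 2 u^{-3} u_x^2 − ε (1 + u^{-2}) u_x. Then the pointwise identity (x + ε(t + x²/2)) · Δ = ∂_t[ x u + ε (t + x²/2) u ] + ∂_x[ − x u^{-2} u_x − u^{-1} − ε( (t + x²/2) u^{-2} u_x + x u ) ] − ε² (t + x²/2)(1 + u^{-2}) u_x holds; in particular the multiplier x + ε(t + x²/2) turns Δ into a total divergence up to a remainder of order ε². -/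
noncomputable def pt (f : ℝ × ℝ → ℝ) : ℝ × ℝ → ℝ := fun p => deriv (fun s => f (s, p.2)) p.1
noncomputable def px (f : ℝ × ℝ → ℝ) : ℝ × ℝ → ℝ := fun p => deriv (fun y => f (p.1, y)) p.2

theorem HasDerivAt.zpow_neg_two {f : ℝ → ℝ} {f' x : ℝ} (hf : HasDerivAt f f' x) (hx : f x ≠ 0) :
    HasDerivAt (fun y => f y ^ (-2 : ℤ)) (-2 * f x ^ (-3 : ℤ) * f') x :=
  ((hasDerivAt_zpow (-2) (f x) (Or.inl hx)).comp x hf).congr_deriv (by norm_num)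

theorem stmt1 (u : ℝ × ℝ → ℝ) (hu : ContDiff ℝ (⊤ : ℕ∞) u)
    (hne : ∀ p : ℝ × ℝ, u p ≠ 0) (ε : ℝ) :
    ∀ p : ℝ × ℝ,
      (p.2 + ε * (p.1 + p.2 ^ 2 / 2)) *
        (pt u p - (u p) ^ (-2 : ℤ) * px (px u) p + 2 * (u p) ^ (-3 : ℤ) * (px u p) ^ 2
          - ε * (1 + (u p) ^ (-2 : ℤ)) * px u p) =
      pt (fun q => q.2 * u q + ε * (q.1 + q.2 ^ 2 / 2) * u q) p
      + px (fun q => -q.2 * (u q) ^ (-2 : ℤ) * px u q - (u q)⁻¹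
          - ε * ((q.1 + q.2 ^ 2 / 2) * (u q) ^ (-2 : ℤ) * px u q + q.2 * u q)) p
      - ε ^ 2 * (p.1 + p.2 ^ 2 / 2) * (1 + (u p) ^ (-2 : ℤ)) * px u p := by
  rintro ⟨a, b⟩
  have hslice : ContDiff ℝ (⊤ : ℕ∞) (fun y => u (a, y)) := by fun_prop
  have ht : HasDerivAt (fun s => u (s, b)) (pt u (a, b)) a := by
    have h : ContDiff ℝ (⊤ : ℕ∞) (fun s => u (s, b)) := by fun_prop
    exact (h.differentiable (by simp)).differentiableAt.hasDerivAt
  have hx : HasDerivAt (fun y => u (a, y)) (px u (a, b)) b :=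
    (hslice.differentiable (by simp)).differentiableAt.hasDerivAt
  have hxx : HasDerivAt (fun y => px u (a, y)) (px (px u) (a, b)) b := by
    have h : ContDiff ℝ (⊤ : ℕ∞) (deriv fun y => u (a, y)) :=
      (contDiff_infty_iff_deriv.1 hslice).2
    exact (h.differentiable (by simp)).differentiableAt.hasDerivAt
  have hz := hx.zpow_neg_two (hne (a, b))
  have hid := hasDerivAt_id' b
  have hA : HasDerivAt (fun y : ℝ => a + y ^ 2 / 2) b b :=
    (((hid.pow 2).div_const 2).const_add a).congr_deriv (by norm_num)
  have hdensity : pt (fun q => q.2 * u q + ε * (q.1 + q.2 ^ 2 / 2) * u q) (a, b) = _ :=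
    ((ht.const_mul b).add
      ((((hasDerivAt_id' a).add_const (b ^ 2 / 2)).const_mul ε).mul ht)).deriv
  have hflux : px (fun q => -q.2 * (u q) ^ (-2 : ℤ) * px u q - (u q)⁻¹
      - ε * ((q.1 + q.2 ^ 2 / 2) * (u q) ^ (-2 : ℤ) * px u q + q.2 * u q)) (a, b) = _ :=
    ((((hid.neg.mul hz).mul hxx).sub (hx.inv (hne (a, b)))).sub
      ((((hA.mul hz).mul hxx).add (hid.mul hx)).const_mul ε)).deriv
  rw [hdensity, hflux]
  have h0 := hne (a, b)
  simp only [Pi.mul_apply, Pi.neg_apply]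
  field_simp
  ring
end

section
/- Let u₀, u₁ : ℝ × ℝ → ℝ be C^∞ functions of (t,x) with u₀(t,x) ≠ 0 for all (t,x). Set Δ₀ = u₀_t − u₀^{-2} u₀_{xx} + 2 u₀^{-3} u₀_x² and Δ₁ = u₁_t + 2 u₀^{-3} u₁ u₀_{xx} − u₀^{-2} u₁_{xx} − 6 u₀^{-4} u₁ u₀_x² + 4 u₀^{-3} u₀_x u₁_x − (1 + u₀^{-2}) u₀_x. Then the pointwise identity (t + x²/2) Δ₀ + x Δ₁ = ∂_t[ (t + x²/2) u₀ + x u₁ ] + ∂_x[ (−(t + x²/2) u₀^{-2} + 2 x u₀^{-3} u₁) u₀_x − x u₀^{-2} u₁_x − x u₀ + u₀^{-2} u₁ ] holds. -/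
theorem hasDerivAt_pt {f : ℝ × ℝ → ℝ} (hf : Differentiable ℝ f) (t x : ℝ) :
    HasDerivAt (fun s => f (s, x)) (pt f (t, x)) t :=
  DifferentiableAt.hasDerivAt (f := fun s => f (s, x)) (by fun_prop)

theorem hasDerivAt_px {f : ℝ × ℝ → ℝ} (hf : Differentiable ℝ f) (t x : ℝ) :
    HasDerivAt (fun y => f (t, y)) (px f (t, x)) x :=
  DifferentiableAt.hasDerivAt (f := fun y => f (t, y)) (by fun_prop)

theorem px_eq_fderiv {f : ℝ × ℝ → ℝ} (hf : Differentiable ℝ f) :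
    px f = fun p => fderiv ℝ f p (0, 1) := by
  funext p
  exact ((hf p).hasFDerivAt.comp_hasDerivAt p.2
    ((hasDerivAt_const p.2 p.1).prodMk (hasDerivAt_id p.2))).deriv

theorem differentiable_px {f : ℝ × ℝ → ℝ} (hf : ContDiff ℝ 2 f) : Differentiable ℝ (px f) := by
  rw [px_eq_fderiv (hf.differentiable (by norm_num))]
  have h : Differentiable ℝ (fderiv ℝ f) :=
    (hf.fderiv_right (m := 1) (by norm_num)).differentiable (by norm_num)
  fun_prop

theorem stmt4 (u₀ u₁ : ℝ × ℝ → ℝ) (hu₀ : ContDiff ℝ (⊤ : ℕ∞) u₀) (hu₁ : ContDiff ℝ (⊤ : ℕ∞) u₁)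
    (hne : ∀ p : ℝ × ℝ, u₀ p ≠ 0) :
    ∀ p : ℝ × ℝ,
      (p.1 + p.2 ^ 2 / 2) *
        (pt u₀ p - (u₀ p) ^ (-2 : ℤ) * px (px u₀) p + 2 * (u₀ p) ^ (-3 : ℤ) * (px u₀ p) ^ 2)
      + p.2 *
        (pt u₁ p + 2 * (u₀ p) ^ (-3 : ℤ) * u₁ p * px (px u₀) p
          - (u₀ p) ^ (-2 : ℤ) * px (px u₁) p
          - 6 * (u₀ p) ^ (-4 : ℤ) * u₁ p * (px u₀ p) ^ 2
          + 4 * (u₀ p) ^ (-3 : ℤ) * px u₀ p * px u₁ p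
          - (1 + (u₀ p) ^ (-2 : ℤ)) * px u₀ p) =
      pt (fun q => (q.1 + q.2 ^ 2 / 2) * u₀ q + q.2 * u₁ q) p
      + px (fun q =>
          (-(q.1 + q.2 ^ 2 / 2) * (u₀ q) ^ (-2 : ℤ) + 2 * q.2 * (u₀ q) ^ (-3 : ℤ) * u₁ q) * px u₀ q
          - q.2 * (u₀ q) ^ (-2 : ℤ) * px u₁ q - q.2 * u₀ q + (u₀ q) ^ (-2 : ℤ) * u₁ q) p := by
  rintro ⟨t, x⟩
  have hv₀ : ContDiff ℝ 2 u₀ := contDiff_infty.1 hu₀ 2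
  have hv₁ : ContDiff ℝ 2 u₁ := contDiff_infty.1 hu₁ 2
  have d₀ : Differentiable ℝ u₀ := hv₀.differentiable (by norm_num)
  have d₁ : Differentiable ℝ u₁ := hv₁.differentiable (by norm_num)
  have hx := hasDerivAt_px d₀ t x
  have hx₁ := hasDerivAt_px d₁ t x
  have hxx := hasDerivAt_px (differentiable_px hv₀) t x
  have hxx₁ := hasDerivAt_px (differentiable_px hv₁) t x
  have hu := hne (t, x)
  have inv_pow (n : ℤ) := (hasDerivAt_zpow n _ (Or.inl hu)).comp x hx
  have id_x := hasDerivAt_id x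
  have ha : HasDerivAt (fun y : ℝ => -(t + y ^ 2 / 2)) (-x) x := by
    refine (((id_x.pow 2).div_const 2).const_add t).neg.congr_deriv ?_
    simp
  have density := (((hasDerivAt_id t).add_const (x ^ 2 / 2)).mul (hasDerivAt_pt d₀ t x)).add
    ((hasDerivAt_pt d₁ t x).const_mul x)
  have flux := ((((((ha.mul (inv_pow (-2))).add
    (((id_x.const_mul 2).mul (inv_pow (-3))).mul hx₁)).mul hxx).sub
    ((id_x.mul (inv_pow (-2))).mul hxx₁)).sub (id_x.mul hx)).add ((inv_pow (-2)).mul hx₁))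
  have e₁ : pt (fun q => (q.1 + q.2 ^ 2 / 2) * u₀ q + q.2 * u₁ q) (t, x) = _ := density.deriv
  have e₂ : px (fun q =>
      (-(q.1 + q.2 ^ 2 / 2) * (u₀ q) ^ (-2 : ℤ) + 2 * q.2 * (u₀ q) ^ (-3 : ℤ) * u₁ q) * px u₀ q
      - q.2 * (u₀ q) ^ (-2 : ℤ) * px u₁ q - q.2 * u₀ q + (u₀ q) ^ (-2 : ℤ) * u₁ q) (t, x) = _ :=
    flux.deriv
  rw [e₁, e₂]
  simp only [Function.comp_apply, Pi.mul_apply, Pi.add_apply, id]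
  norm_num
  ring
end

section
/- Let u₀ : ℝ × ℝ → ℝ be a C^∞ function of (t,x). Set Δ₀ = u₀_t + u₀ u₀_x + u₀_{xxx}. Then the pointwise identity (t u₀ − x) Δ₀ = ∂_t[ ((t u₀ − x)²/2) u₀_x ] + ∂_x[ (t u₀ − x) u₀_{xx} − (t/2) u₀_x² − ((t u₀ − x)²/2) u₀_t + u₀_x ] holds. -/
theorem hasDerivAt_pt_s7 {f : ℝ × ℝ → ℝ} {p : ℝ × ℝ} (hf : DifferentiableAt ℝ f p) :
    HasDerivAt (fun s => f (s, p.2)) (fderiv ℝ f p (1, 0)) p.1 :=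
  HasFDerivAt.comp_hasDerivAt (f := fun s : ℝ => (s, p.2)) p.1 hf.hasFDerivAt
    ((hasDerivAt_id p.1).prodMk (hasDerivAt_const p.1 p.2))

theorem hasDerivAt_px_s7 {f : ℝ × ℝ → ℝ} {p : ℝ × ℝ} (hf : DifferentiableAt ℝ f p) :
    HasDerivAt (fun y => f (p.1, y)) (fderiv ℝ f p (0, 1)) p.2 :=
  HasFDerivAt.comp_hasDerivAt (f := fun y : ℝ => (p.1, y)) p.2 hf.hasFDerivAt
    ((hasDerivAt_const p.2 p.1).prodMk (hasDerivAt_id p.2))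

theorem pt_eq_fderiv {f : ℝ × ℝ → ℝ} (hf : Differentiable ℝ f) :
    pt f = fun p => fderiv ℝ f p (1, 0) :=
  funext fun p => (hasDerivAt_pt_s7 (hf p)).deriv

theorem contDiff_pt {f : ℝ × ℝ → ℝ} (hf : ContDiff ℝ (⊤ : ℕ∞) f) :
    ContDiff ℝ (⊤ : ℕ∞) (pt f) := by
  rw [pt_eq_fderiv (hf.differentiable (by simp))]
  exact (hf.fderiv_right (by simp)).clm_apply contDiff_const

theorem contDiff_px {f : ℝ × ℝ → ℝ} (hf : ContDiff ℝ (⊤ : ℕ∞) f) :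
    ContDiff ℝ (⊤ : ℕ∞) (px f) := by
  rw [px_eq_fderiv (hf.differentiable (by simp))]
  exact (hf.fderiv_right (by simp)).clm_apply contDiff_const

theorem ContDiff.hasDerivAt_pt {f : ℝ × ℝ → ℝ} (hf : ContDiff ℝ (⊤ : ℕ∞) f) (p : ℝ × ℝ) :
    HasDerivAt (fun s => f (s, p.2)) (_root_.pt f p) p.1 :=
  (_root_.hasDerivAt_pt_s7 (hf.differentiable (by simp) p)).differentiableAt.hasDerivAt

theorem ContDiff.hasDerivAt_px {f : ℝ × ℝ → ℝ} (hf : ContDiff ℝ (⊤ : ℕ∞) f) (p : ℝ × ℝ) :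
    HasDerivAt (fun y => f (p.1, y)) (_root_.px f p) p.2 :=
  (_root_.hasDerivAt_px_s7 (hf.differentiable (by simp) p)).differentiableAt.hasDerivAt

theorem pt_px_comm {f : ℝ × ℝ → ℝ} (hf : ContDiff ℝ (⊤ : ℕ∞) f) (p : ℝ × ℝ) :
    pt (px f) p = px (pt f) p := by
  have hd : Differentiable ℝ f := hf.differentiable (by simp)
  have hdd : DifferentiableAt ℝ (fderiv ℝ f) p :=
    (hf.fderiv_right (m := (⊤ : ℕ∞)) (by simp)).differentiable (by simp) p
  have hsymm : IsSymmSndFDerivAt ℝ f p := hf.contDiffAt.isSymmSndFDerivAt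
    (by simpa using WithTop.coe_le_coe.mpr (le_top : (2 : ℕ∞) ≤ ⊤))
  rw [pt_eq_fderiv ((contDiff_px hf).differentiable (by simp)),
    px_eq_fderiv ((contDiff_pt hf).differentiable (by simp)), px_eq_fderiv hd, pt_eq_fderiv hd]
  simp only [fderiv_clm_apply hdd (differentiableAt_const _)]
  simpa using hsymm (1, 0) (0, 1)

theorem stmt7 (u₀ : ℝ × ℝ → ℝ) (hu : ContDiff ℝ (⊤ : ℕ∞) u₀) :
    ∀ p : ℝ × ℝ,
      (p.1 * u₀ p - p.2) * (pt u₀ p + u₀ p * px u₀ p + px (px (px u₀)) p) =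
      pt (fun q => ((q.1 * u₀ q - q.2) ^ 2 / 2) * px u₀ q) p
      + px (fun q => (q.1 * u₀ q - q.2) * px (px u₀) q - (q.1 / 2) * (px u₀ q) ^ 2
          - ((q.1 * u₀ q - q.2) ^ 2 / 2) * pt u₀ q + px u₀ q) p := by
  intro p
  have hwt := ((hasDerivAt_id p.1).mul (hu.hasDerivAt_pt p)).sub_const p.2
  have hwx := ((hu.hasDerivAt_px p).const_mul p.1).sub (hasDerivAt_id p.2)
  have hT := (((hwt.pow 2).div_const 2).mul ((contDiff_px hu).hasDerivAt_pt p)).deriv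
  have hX := ((((hwx.mul ((contDiff_px (contDiff_px hu)).hasDerivAt_px p)).sub
    ((((contDiff_px hu).hasDerivAt_px p).pow 2).const_mul (p.1 / 2))).sub
    (((hwx.pow 2).div_const 2).mul ((contDiff_pt hu).hasDerivAt_px p))).add ((contDiff_px hu).hasDerivAt_px p)).deriv
  have hcomm := pt_px_comm hu p
  have hT' : pt (fun q => ((q.1 * u₀ q - q.2) ^ 2 / 2) * px u₀ q) p = _ := hT
  have hX' : px (fun q => (q.1 * u₀ q - q.2) * px (px u₀) q - (q.1 / 2) * (px u₀ q) ^ 2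
      - ((q.1 * u₀ q - q.2) ^ 2 / 2) * pt u₀ q + px u₀ q) p = _ := hX
  rw [hT', hX', hcomm]
  simp
  ring
end

section
/- Let u₀, v₀ : ℝ × ℝ → ℝ be C^∞ functions of (t,x). Set Δ₀² = v₀_t + (1/2) v₀_{xx} + u₀ v₀ v₀_x + (1/2) v₀² u₀_x. Then the pointwise identity Δ₀² = ∂_t[ (1/2) t v₀² u₀_x + (t u₀ v₀ − x) v₀_x ] + ∂_x[ −(1/2) t v₀² u₀_t − (t u₀ v₀ − x) v₀_t + (1/2) v₀_x ] holds. -/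
theorem differentiable_fderiv_of_contDiff {f : ℝ × ℝ → ℝ} (hf : ContDiff ℝ 2 f) :
    Differentiable ℝ (fderiv ℝ f) :=
  (hf.fderiv_right (m := 1) (by norm_num)).differentiable (by norm_num)

theorem differentiable_pt {f : ℝ × ℝ → ℝ} (hf : ContDiff ℝ 2 f) : Differentiable ℝ (pt f) := by
  rw [pt_eq_fderiv (hf.differentiable (by norm_num))]
  exact (differentiable_fderiv_of_contDiff hf).clm_apply (differentiable_const _)

theorem pt_px_eq_px_pt {f : ℝ × ℝ → ℝ} (hf : ContDiff ℝ 2 f) (p : ℝ × ℝ) :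
    pt (px f) p = px (pt f) p := by
  have hd := hf.differentiable (by norm_num)
  have hd' := differentiable_fderiv_of_contDiff hf
  rw [pt_eq_fderiv (differentiable_px hf), px_eq_fderiv (differentiable_pt hf),
    pt_eq_fderiv hd, px_eq_fderiv hd]
  have key : ∀ v w : ℝ × ℝ,
      fderiv ℝ (fun q => fderiv ℝ f q v) p w = fderiv ℝ (fderiv ℝ f) p w v := fun v w => by
    rw [fderiv_clm_apply (hd' p) (differentiableAt_const v)]
    simp
  simp only [key]
  exact (hf.contDiffAt.isSymmSndFDerivAt (by simp)) _ _


theorem stmt18 (u₀ v₀ : ℝ × ℝ → ℝ)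
    (hu₀ : ContDiff ℝ (⊤ : ℕ∞) u₀) (hv₀ : ContDiff ℝ (⊤ : ℕ∞) v₀) :
    ∀ p : ℝ × ℝ,
      pt v₀ p + (1 / 2) * px (px v₀) p + u₀ p * v₀ p * px v₀ p
        + (1 / 2) * (v₀ p) ^ 2 * px u₀ p =
      pt (fun q => (1 / 2) * q.1 * (v₀ q) ^ 2 * px u₀ q
          + (q.1 * u₀ q * v₀ q - q.2) * px v₀ q) p
      + px (fun q => -(1 / 2) * q.1 * (v₀ q) ^ 2 * pt u₀ q
          - (q.1 * u₀ q * v₀ q - q.2) * pt v₀ q + (1 / 2) * px v₀ q) p := by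
  rintro ⟨t, x⟩
  have hu : ContDiff ℝ 2 u₀ := hu₀.of_le (WithTop.coe_le_coe.2 le_top)
  have hv : ContDiff ℝ 2 v₀ := hv₀.of_le (WithTop.coe_le_coe.2 le_top)
  have du := hu.differentiable (by norm_num)
  have dv := hv.differentiable (by norm_num)
  have ht : HasDerivAt (fun s => (1 / 2) * s * (v₀ (s, x)) ^ 2 * px u₀ (s, x)
      + (s * u₀ (s, x) * v₀ (s, x) - x) * px v₀ (s, x)) _ t :=
    ((((hasDerivAt_id t).const_mul (1 / 2)).mul ((hasDerivAt_pt dv t x).pow 2)).mul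
      (hasDerivAt_pt (differentiable_px hu) t x)).add
    (((((hasDerivAt_id t).mul (hasDerivAt_pt du t x)).mul (hasDerivAt_pt dv t x)).sub_const x).mul
      (hasDerivAt_pt (differentiable_px hv) t x))
  have hx : HasDerivAt (fun y => -(1 / 2) * t * (v₀ (t, y)) ^ 2 * pt u₀ (t, y)
      - (t * u₀ (t, y) * v₀ (t, y) - y) * pt v₀ (t, y) + (1 / 2) * px v₀ (t, y)) _ x :=
    (((((hasDerivAt_px dv t x).pow 2).const_mul (-(1 / 2) * t)).mul
      (hasDerivAt_px (differentiable_pt hu) t x)).sub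
    (((((hasDerivAt_px du t x).const_mul t).mul (hasDerivAt_px dv t x)).sub (hasDerivAt_id x)).mul
      (hasDerivAt_px (differentiable_pt hv) t x))).add
    ((hasDerivAt_px (differentiable_px hv) t x).const_mul (1 / 2))
  have et := ht.deriv
  have ex := hx.deriv
  change _ = deriv _ _ + deriv _ _
  dsimp only
  rw [et, ex, pt_px_eq_px_pt hu, pt_px_eq_px_pt hv]
  simp only [Pi.mul_apply, Pi.pow_apply, Pi.sub_apply, id]
  norm_num
  ring
end
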